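/- Every factor of a Sturmian word has at most three semi-abelian returns. -/

import Mathlib

/-- The factor of length `n` of the infinite word `w` starting at position `i`. -/
def wordAt {α : Type*} (w : ℕ → α) (i n : ℕ) : List α :=
  (List.range n).map (fun k => w (i + k))

/-- `u` is a factor of the infinite word `w`. -/
def IsFactorW {α : Type*} (w : ℕ → α) (u : List α) : Prop :=
  ∃ i, u = wordAt w i u.length

/-- `w` is recurrent: every factor occurs infinitely often. -/
def RecurrentW {α : Type*} (w : ℕ → α) : Prop :=
  ∀ u, IsFactorW w u → ∀ N, ∃ i, N ≤ i ∧ u = wordAt w i u.length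

/-- `w` is (purely) periodic. -/
def PeriodicW {α : Type*} (w : ℕ → α) : Prop :=
  ∃ T, 0 < T ∧ ∀ n, w (n + T) = w n

/-- `w` is ultimately periodic. -/
def UltPeriodicW {α : Type*} (w : ℕ → α) : Prop :=
  ∃ T, 0 < T ∧ ∃ n₀, ∀ n, n₀ ≤ n → w (n + T) = w n

/-- Two finite words are abelian equivalent: same number of occurrences of each letter. -/
def AbEquiv {α : Type*} [DecidableEq α] (u v : List α) : Prop :=
  ∀ a : α, u.count a = v.count a

/-- Positions of occurrences of words abelian equivalent to `u` in `w`. -/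
def abOcc {α : Type*} [DecidableEq α] (w : ℕ → α) (u : List α) : Set ℕ :=
  {i | AbEquiv (wordAt w i u.length) u}

/-- The semi-abelian returns to (the abelian class of) `u` in `w`: words extending from one
occurrence of the abelian class of `u` to the next one. -/
def semiAbReturns {α : Type*} [DecidableEq α] (w : ℕ → α) (u : List α) : Set (List α) :=
  {r | ∃ i j, i ∈ abOcc w u ∧ j ∈ abOcc w u ∧ i < j ∧
      (∀ k, i < k → k < j → k ∉ abOcc w u) ∧ r = wordAt w i (j - i)}

/-- Positions of (exact) occurrences of `u` in `w`. -/
def occW {α : Type*} [DecidableEq α] (w : ℕ → α) (u : List α) : Set ℕ :=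
  {i | u = wordAt w i u.length}

/-- The ordinary return words of `u` in `w`. -/
def returnWords {α : Type*} [DecidableEq α] (w : ℕ → α) (u : List α) : Set (List α) :=
  {r | ∃ i j, i ∈ occW w u ∧ j ∈ occW w u ∧ i < j ∧
      (∀ k, i < k → k < j → k ∉ occW w u) ∧ r = wordAt w i (j - i)}

/-- `u` has exactly `k` semi-abelian returns in `w`. -/
def ExactlyKSemiAbReturns {α : Type*} [DecidableEq α] (w : ℕ → α) (u : List α) (k : ℕ) : Prop :=
  ∃ f : Fin k → List α, Function.Injective f ∧ semiAbReturns w u = Set.range f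

/-- `u` has exactly `k` abelian returns in `w`: there are `k` pairwise non-abelian-equivalent
representatives so that every semi-abelian return is abelian equivalent to exactly one of them,
and each representative is realized. -/
def ExactlyKAbReturns {α : Type*} [DecidableEq α] (w : ℕ → α) (u : List α) (k : ℕ) : Prop :=
  ∃ f : Fin k → List α,
    (∀ i j, AbEquiv (f i) (f j) → i = j) ∧
    (∀ r ∈ semiAbReturns w u, ∃ i, AbEquiv r (f i)) ∧
    (∀ i, ∃ r ∈ semiAbReturns w u, AbEquiv r (f i))

/-- `u` has at most `k` abelian returns in `w`. -/
def AtMostKAbReturns {α : Type*} [DecidableEq α] (w : ℕ → α) (u : List α) (k : ℕ) : Prop :=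
  ∃ f : Fin k → List α, ∀ r ∈ semiAbReturns w u, ∃ i, AbEquiv r (f i)

/-- `u` has at least `k` abelian returns in `w`. -/
def AtLeastKAbReturns {α : Type*} [DecidableEq α] (w : ℕ → α) (u : List α) (k : ℕ) : Prop :=
  ∃ f : Fin k → List α,
    (∀ i j, AbEquiv (f i) (f j) → i = j) ∧
    (∀ i, ∃ r ∈ semiAbReturns w u, AbEquiv r (f i))

/-- `u` has at least two semi-abelian returns in `w`. -/
def AtLeastTwoSemiAbReturns {α : Type*} [DecidableEq α] (w : ℕ → α) (u : List α) : Prop :=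
  ∃ r₁ r₂, r₁ ∈ semiAbReturns w u ∧ r₂ ∈ semiAbReturns w u ∧ r₁ ≠ r₂

/-- The factor complexity of `w`. -/
noncomputable def complexityW {α : Type*} (w : ℕ → α) (n : ℕ) : ℕ :=
  {u : List α | u.length = n ∧ IsFactorW w u}.ncard

/-- A Sturmian word: aperiodic binary word with factor complexity `n + 1`. -/
def SturmianW (w : ℕ → Bool) : Prop :=
  ¬ UltPeriodicW w ∧ ∀ n, complexityW w n = n + 1

/-- Right special factor of a binary word. -/
def RightSpecial (w : ℕ → Bool) (B : List Bool) : Prop :=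
  IsFactorW w (B ++ [false]) ∧ IsFactorW w (B ++ [true])

/-- Left special factor of a binary word. -/
def LeftSpecial (w : ℕ → Bool) (B : List Bool) : Prop :=
  IsFactorW w (false :: B) ∧ IsFactorW w (true :: B)

/-- Bispecial factor of a binary word. -/
def Bispecial (w : ℕ → Bool) (B : List Bool) : Prop :=
  RightSpecial w B ∧ LeftSpecial w B

/-- `w` is `c`-balanced. -/
def CBalanced {α : Type*} [DecidableEq α] (w : ℕ → α) (c : ℕ) : Prop :=
  ∀ u v : List α, IsFactorW w u → IsFactorW w v → u.length = v.length →
    ∀ a : α, |((u.count a : ℤ) - (v.count a : ℤ))| ≤ (c : ℤ)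

theorem wordAt_length {α : Type*} (w : ℕ → α) (i n : ℕ) : (wordAt w i n).length = n := by
  simp [wordAt]

theorem wordAt_eq_iff {α : Type*} {w : ℕ → α} {i j n : ℕ} :
    wordAt w i n = wordAt w j n ↔ ∀ m < n, w (i + m) = w (j + m) := by
  simp [wordAt, List.map_inj_left]

theorem wordAt_succ {α : Type*} (w : ℕ → α) (i n : ℕ) :
    wordAt w i (n + 1) = wordAt w i n ++ [w (i + n)] := by
  simp [wordAt, List.range_succ]

theorem wordAt_succ_eq_iff {α : Type*} {w : ℕ → α} {i j n : ℕ} :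
    wordAt w i (n + 1) = wordAt w j (n + 1) ↔
      wordAt w i n = wordAt w j n ∧ w (i + n) = w (j + n) := by
  rw [wordAt_succ, wordAt_succ]
  constructor
  · intro h
    have h' := List.append_inj' h rfl
    simpa using h'
  · rintro ⟨h1, h2⟩
    rw [h1, h2]

/-- The set of factors of length `n`. -/
def factorSet (w : ℕ → Bool) (n : ℕ) : Set (List Bool) :=
  {u : List Bool | u.length = n ∧ IsFactorW w u}

theorem wordAt_mem_factorSet (w : ℕ → Bool) (i n : ℕ) : wordAt w i n ∈ factorSet w n :=
  ⟨wordAt_length w i n, i, by rw [wordAt_length]⟩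

theorem exists_of_mem_factorSet {w : ℕ → Bool} {n : ℕ} {u : List Bool}
    (hu : u ∈ factorSet w n) : ∃ i, u = wordAt w i n := by
  obtain ⟨h1, i, hi⟩ := hu
  exact ⟨i, by rw [← h1]; exact hi⟩

theorem SturmianW.ncard_factorSet {w : ℕ → Bool} (hst : SturmianW w) (n : ℕ) :
    (factorSet w n).ncard = n + 1 := hst.2 n

theorem SturmianW.finite_factorSet {w : ℕ → Bool} (hst : SturmianW w) (n : ℕ) :
    (factorSet w n).Finite :=
  Set.finite_of_ncard_pos (by rw [hst.ncard_factorSet]; omega)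

/-- A Sturmian word has at most one right special factor of each length. -/
theorem SturmianW.rightSpecial_unique {w : ℕ → Bool} (hst : SturmianW w) {n i i' j j' : ℕ}
    (hi : wordAt w i n = wordAt w i' n) (hi' : w (i + n) ≠ w (i' + n))
    (hj : wordAt w j n = wordAt w j' n) (hj' : w (j + n) ≠ w (j' + n)) :
    wordAt w i n = wordAt w j n := by
  by_contra hne
  have hex : ∀ v : List Bool, ∃ k, v ∈ factorSet w n → v = wordAt w k n := by
    intro v
    by_cases hv : v ∈ factorSet w n
    · obtain ⟨k, hk⟩ := exists_of_mem_factorSet hv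
      exact ⟨k, fun _ => hk⟩
    · exact ⟨0, fun h => absurd h hv⟩
  choose pos hpos using hex
  set e : List Bool → List Bool := fun v => wordAt w (pos v) (n + 1) with he
  have hinj : Set.InjOn e (factorSet w n) := by
    intro a ha b hb hab
    rw [hpos a ha, hpos b hb]
    exact (wordAt_succ_eq_iff.1 hab).1
  have hmem : ∀ k, wordAt w k (n + 1) ∈ e '' factorSet w n →
      wordAt w k (n + 1) = wordAt w (pos (wordAt w k n)) (n + 1) := by
    rintro k ⟨v, hv, hvk⟩
    have h1 := (wordAt_succ_eq_iff.1 hvk).1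
    rw [← hpos v hv] at h1
    rw [← h1]
    exact hvk.symm
  have hextra : ∀ a b, wordAt w a n = wordAt w b n → w (a + n) ≠ w (b + n) →
      ∃ c, wordAt w c n = wordAt w a n ∧ wordAt w c (n + 1) ∉ e '' factorSet w n := by
    intro a b hab hab'
    by_contra! hcon
    have h1 := hmem a (hcon a rfl)
    have h2 := hmem b (hcon b hab.symm)
    rw [hab] at h1
    exact hab' (wordAt_succ_eq_iff.1 (h1.trans h2.symm)).2
  obtain ⟨c, hc, hc'⟩ := hextra i i' hi hi'
  obtain ⟨d, hd, hd'⟩ := hextra j j' hj hj'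
  have hcd : wordAt w c (n + 1) ≠ wordAt w d (n + 1) := by
    intro h
    exact hne (by rw [← hc, ← hd]; exact (wordAt_succ_eq_iff.1 h).1)
  have hfin : (e '' factorSet w n).Finite := (hst.finite_factorSet n).image e
  have hsub : insert (wordAt w c (n + 1)) (insert (wordAt w d (n + 1)) (e '' factorSet w n)) ⊆
      factorSet w (n + 1) := by
    intro z hz
    rcases hz with rfl | rfl | ⟨v, -, rfl⟩ <;> exact wordAt_mem_factorSet _ _ _
  have hcard := Set.ncard_le_ncard hsub (hst.finite_factorSet (n + 1))
  rw [Set.ncard_insert_of_notMem (by simp only [Set.mem_insert_iff, not_or]; exact ⟨hcd, hc'⟩)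
      (hfin.insert _), Set.ncard_insert_of_notMem hd' hfin, hinj.ncard_image,
    hst.ncard_factorSet, hst.ncard_factorSet] at hcard
  omega

/-- If the factors of length `n` at `a` and `a + T` agree and no factor of length `n` read in
between is right special, then the word is ultimately periodic. -/
theorem ultPeriodicW_of_not_rightSpecial {w : ℕ → Bool} {n a T : ℕ} (hT : 0 < T)
    (hrep : wordAt w a n = wordAt w (a + T) n)
    (hns : ∀ h < T, ∀ j, wordAt w (a + h) n = wordAt w j n → w (a + h + n) = w (j + n)) :
    UltPeriodicW w := by
  have key : ∀ m, wordAt w (a + m) n = wordAt w (a + m + T) n ∧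
      ∀ j, wordAt w (a + m) n = wordAt w j n → w (a + m + n) = w (j + n) := by
    intro m
    induction m using Nat.strong_induction_on with
    | _ m ih =>
      constructor
      · cases m with
        | zero => exact hrep
        | succ m =>
          obtain ⟨h1, h2⟩ := ih m (by omega)
          have h3 := h2 _ h1
          have h4 := wordAt_eq_iff.1 (wordAt_succ_eq_iff.2 ⟨h1, h3⟩)
          refine wordAt_eq_iff.2 fun k hk => ?_
          have h5 := h4 (k + 1) (by omega)
          convert h5 using 2 <;> omega
      · by_cases hm : m < T
        · exact hns m hm
        · obtain ⟨h1, h2⟩ := ih (m - T) (by omega)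
          have h3 := h2 _ h1
          have e1 : a + (m - T) + T = a + m := by omega
          rw [e1] at h1 h3
          intro j hj
          rw [← h3]
          exact h2 j (h1.trans hj)
  refine ⟨T, hT, a + n, fun k hk => ?_⟩
  obtain ⟨h1, h2⟩ := key (k - a - n)
  have h3 := h2 _ h1
  have e1 : a + (k - a - n) + n = k := by omega
  have e2 : a + (k - a - n) + T + n = k + T := by omega
  rw [e1, e2] at h3
  exact h3.symm

/-- Two occurrences `a p a` (at `i`) and `b p b` (at `j`) with `b ≠ a` and `p` of length `L`. -/
def UnbalancedPair (w : ℕ → Bool) (L i j : ℕ) : Prop :=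
  w i = w (i + L + 1) ∧ w j = w (j + L + 1) ∧ w i ≠ w j ∧ ∀ m < L, w (i + 1 + m) = w (j + 1 + m)

theorem UnbalancedPair.symm {w : ℕ → Bool} {L i j : ℕ} (h : UnbalancedPair w L i j) :
    UnbalancedPair w L j i :=
  ⟨h.2.1, h.1, h.2.2.1.symm, fun m hm => (h.2.2.2 m hm).symm⟩

theorem UnbalancedPair.false_of_not_rightSpecial {w : ℕ → Bool} (hst : SturmianW w) {L i j : ℕ}
    (h : UnbalancedPair w L i j) (hmin : ∀ M < L, ∀ i j, ¬ UnbalancedPair w M i j)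
    (hns : ∀ k, wordAt w i (L + 1) = wordAt w k (L + 1) → w (i + (L + 1)) = w (k + (L + 1))) :
    False := by
  obtain ⟨h1, h2, h3, h4⟩ := h
  have hlast : w (i + L + 1) ≠ w (j + L + 1) := by rw [← h1, ← h2]; exact h3
  have avoid : ∀ t ≤ L + 1, wordAt w (i + t) (L + 1) ≠ wordAt w j (L + 1) := by
    intro t ht heq
    have heq' := wordAt_eq_iff.1 heq
    have h0 : w (i + t) = w j := heq' 0 (by omega)
    by_cases ht0 : t = 0
    · subst ht0; exact h3 h0
    by_cases htL : t = L + 1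
    · subst htL
      exact h3 (by rw [h1]; exact h0)
    refine hmin (L - t) (by omega) i (j + t) ⟨?_, ?_, ?_, ?_⟩
    · rw [h1]
      have e1 := heq' (L - t + 1) (by omega)
      have e2 := h4 (L - t) (by omega)
      rw [show i + t + (L - t + 1) = i + L + 1 by omega,
        show j + (L - t + 1) = j + 1 + (L - t) by omega, ← e2] at e1
      rw [e1]
      congr 1; omega
    · have e2 := h4 (t - 1) (by omega)
      rw [show i + 1 + (t - 1) = i + t by omega, show j + 1 + (t - 1) = j + t by omega] at e2
      rw [← e2, h0, h2]
      congr 1; omega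
    · have e2 := h4 (t - 1) (by omega)
      rw [show i + 1 + (t - 1) = i + t by omega, show j + 1 + (t - 1) = j + t by omega] at e2
      rw [← e2, h0]
      exact h3
    · intro m hm
      have e1 := heq' (m + 1) (by omega)
      have e2 := h4 m (by omega)
      have e3 := h4 (t + m) (by omega)
      rw [show i + t + (m + 1) = i + 1 + (t + m) by omega, e3,
        show j + (m + 1) = j + 1 + m by omega, ← e2] at e1
      rw [← e1]
      congr 1; omega
  have nonspecial : ∀ t ≤ L + 1, ∀ k, wordAt w (i + t) (L + 1) = wordAt w k (L + 1) →
      w (i + t + (L + 1)) = w (k + (L + 1)) := by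
    intro t ht k hk
    by_contra hne
    have hk' := wordAt_eq_iff.1 hk
    have htail : wordAt w (i + t + 1) L = wordAt w (i + 1) L := by
      refine hst.rightSpecial_unique (i' := k + 1) (j' := j + 1) ?_ ?_ (wordAt_eq_iff.2 h4) ?_
      · refine wordAt_eq_iff.2 fun m hm => ?_
        have e1 := hk' (m + 1) (by omega)
        convert e1 using 2 <;> omega
      · rw [show i + t + 1 + L = i + t + (L + 1) by omega, show k + 1 + L = k + (L + 1) by omega]
        exact hne
      · rw [show i + 1 + L = i + L + 1 by omega, show j + 1 + L = j + L + 1 by omega]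
        exact hlast
    have htail' := wordAt_eq_iff.1 htail
    have cons_eq : ∀ s, w (i + t) = w s → (∀ m < L, w (i + 1 + m) = w (s + 1 + m)) →
        wordAt w (i + t) (L + 1) = wordAt w s (L + 1) := by
      intro s hs hs'
      refine wordAt_eq_iff.2 fun m hm => ?_
      cases m with
      | zero => exact hs
      | succ m =>
        have e1 := htail' m (by omega)
        have e2 := hs' m (by omega)
        rw [show i + t + (m + 1) = i + t + 1 + m by omega, e1, e2]
        congr 1; omega
    by_cases hw : w (i + t) = w i
    · have e := cons_eq i hw (fun _ _ => rfl)
      exact hne ((hns (i + t) e.symm).symm.trans (hns k (e.symm.trans hk)))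
    · have hw' : w (i + t) = w j := by
        revert hw h3; cases w (i + t) <;> cases w i <;> cases w j <;> simp
      exact avoid t ht (cons_eq j hw' h4)
  have hfin := hst.finite_factorSet (L + 1)
  have hcard : (factorSet w (L + 1) \ {wordAt w j (L + 1)}).ncard = L + 1 := by
    rw [Set.ncard_sdiff_singleton_of_mem (wordAt_mem_factorSet _ _ _), hst.ncard_factorSet]
    omega
  have hfin' := hfin.subset (Set.sdiff_subset (s := factorSet w (L + 1))
    (t := {wordAt w j (L + 1)}))
  rw [Set.ncard_eq_toFinset_card _ hfin'] at hcard
  obtain ⟨s, hs, t, ht, hst', heq⟩ := Finset.exists_ne_map_eq_of_card_lt_of_maps_to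
    (s := Finset.range (L + 2)) (t := hfin'.toFinset) (f := fun t => wordAt w (i + t) (L + 1))
    (by rw [hcard, Finset.card_range]; omega)
    (by
      intro t ht
      have ht' : t < L + 2 := by simpa using ht
      simp only [Set.Finite.coe_toFinset]
      exact ⟨wordAt_mem_factorSet _ _ _, avoid t (by omega)⟩)
  have main : ∀ s t, s < t → t < L + 2 →
      wordAt w (i + s) (L + 1) = wordAt w (i + t) (L + 1) → False := by
    intro s t hlt ht heq
    refine hst.1 (ultPeriodicW_of_not_rightSpecial (n := L + 1) (a := i + s) (T := t - s)
      (by omega) ?_ ?_)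
    · rw [heq]; congr 1; omega
    · intro h hh k hk
      rw [add_assoc i s h] at hk ⊢
      exact nonspecial (s + h) (by omega) k hk
  rw [Finset.mem_range] at hs ht
  rcases lt_or_gt_of_ne hst' with hlt | hlt
  · exact main s t hlt ht heq
  · exact main t s hlt hs heq.symm

theorem SturmianW.not_unbalancedPair {w : ℕ → Bool} (hst : SturmianW w) (L : ℕ) :
    ∀ i j, ¬ UnbalancedPair w L i j := by
  induction L using Nat.strong_induction_on with
  | _ L ih =>
    intro i j h
    by_cases hi : ∀ k, wordAt w i (L + 1) = wordAt w k (L + 1) →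
        w (i + (L + 1)) = w (k + (L + 1))
    · exact h.false_of_not_rightSpecial hst ih hi
    by_cases hj : ∀ k, wordAt w j (L + 1) = wordAt w k (L + 1) →
        w (j + (L + 1)) = w (k + (L + 1))
    · exact h.symm.false_of_not_rightSpecial hst ih hj
    push Not at hi hj
    obtain ⟨k, hk, hk'⟩ := hi
    obtain ⟨l, hl, hl'⟩ := hj
    exact h.2.2.1 (wordAt_eq_iff.1 (hst.rightSpecial_unique hk hk' hl hl') 0 (by omega))

/-- The number of letters `true` among the first `n` letters of `w`. -/
def trueSum (w : ℕ → Bool) (n : ℕ) : ℤ :=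
  ∑ j ∈ Finset.range n, if w j then 1 else 0

theorem trueSum_succ (w : ℕ → Bool) (n : ℕ) :
    trueSum w (n + 1) = trueSum w n + if w n then 1 else 0 :=
  Finset.sum_range_succ _ _

theorem count_true_wordAt (w : ℕ → Bool) (i n : ℕ) :
    ((wordAt w i n).count true : ℤ) = trueSum w (i + n) - trueSum w i := by
  induction n with
  | zero => simp [wordAt]
  | succ n ih =>
    rw [wordAt_succ, List.count_append, Nat.cast_add, ih, ← add_assoc, trueSum_succ]
    cases w (i + n) <;> (simp; try ring)

theorem abEquiv_iff_count_true {u v : List Bool} (h : u.length = v.length) :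
    AbEquiv u v ↔ u.count true = v.count true := by
  constructor
  · intro h'
    exact h' true
  · intro h' a
    have h1 := List.count_true_add_count_false (l := u)
    have h2 := List.count_true_add_count_false (l := v)
    cases a <;> omega

theorem mem_abOcc_iff {w : ℕ → Bool} {u : List Bool} {i : ℕ} :
    i ∈ abOcc w u ↔ trueSum w (i + u.length) - trueSum w i = u.count true := by
  rw [← count_true_wordAt, Nat.cast_inj]
  exact abEquiv_iff_count_true (wordAt_length _ _ _)

theorem SturmianW.balanced {w : ℕ → Bool} (hst : SturmianW w) (n : ℕ) :
    ∀ i j, trueSum w (i + n) - trueSum w i ≤ trueSum w (j + n) - trueSum w j + 1 := by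
  induction n using Nat.strong_induction_on with
  | _ n ih =>
    intro i j
    match n with
    | 0 => simp
    | 1 =>
      rw [trueSum_succ, trueSum_succ]
      cases w i <;> cases w j <;> simp
    | L + 2 =>
      by_contra! hlt
      have hmid : ∀ m, 1 ≤ m → m ≤ L + 1 →
          trueSum w (i + m) - trueSum w i = trueSum w (j + m) - trueSum w j + 1 ∧
          trueSum w (i + (L + 2)) - trueSum w i =
            trueSum w (j + (L + 2)) - trueSum w j + 2 := by
        intro m h1 h2
        have h3 := ih m (by omega) i j
        have h4 := ih (L + 2 - m) (by omega) (i + m) (j + m)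
        rw [show i + m + (L + 2 - m) = i + (L + 2) by omega,
          show j + m + (L + 2 - m) = j + (L + 2) by omega] at h4
        omega
      have hi : w i = true ∧ w j = false := by
        have h1 := (hmid 1 le_rfl (by omega)).1
        rw [trueSum_succ, trueSum_succ] at h1
        revert h1
        cases w i <;> cases w j <;> simp
      have hL : w (i + L + 1) = true ∧ w (j + L + 1) = false := by
        obtain ⟨h1, h2⟩ := hmid (L + 1) (by omega) le_rfl
        rw [show i + (L + 2) = i + L + 1 + 1 by omega,
          show j + (L + 2) = j + L + 1 + 1 by omega, trueSum_succ w (i + L + 1),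
          trueSum_succ w (j + L + 1)] at h2
        rw [← add_assoc, ← add_assoc] at h1
        revert h2
        cases w (i + L + 1) <;> cases w (j + L + 1) <;> simp <;> omega
      refine hst.not_unbalancedPair L i j ⟨by rw [hi.1, hL.1], by rw [hi.2, hL.2],
        by rw [hi.1, hi.2]; simp, fun m hm => ?_⟩
      have h1 := (hmid (m + 1) (by omega) (by omega)).1
      have h2 := (hmid (m + 2) (by omega) (by omega)).1
      rw [show i + (m + 2) = i + 1 + m + 1 by omega,
        show j + (m + 2) = j + 1 + m + 1 by omega, trueSum_succ w (i + 1 + m),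
        trueSum_succ w (j + 1 + m)] at h2
      rw [show i + (m + 1) = i + 1 + m by omega, show j + (m + 1) = j + 1 + m by omega] at h1
      revert h2
      cases w (i + 1 + m) <;> cases w (j + 1 + m) <;> simp <;> omega

theorem mul_le_of_le_block {S : ℕ → ℤ} {c : ℤ} {m : ℕ} (h : ∀ i, c ≤ S (i + m) - S i) (n : ℕ) :
    n * c ≤ S (n * m) - S 0 := by
  induction n with
  | zero => simp
  | succ n ih =>
    have h1 := h (n * m)
    rw [Nat.succ_mul]
    push_cast
    linarith

/-- A balanced sequence of partial sums has a slope. -/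
theorem exists_slope {S : ℕ → ℤ}
    (hb : ∀ n i j, S (i + n) - S i ≤ S (j + n) - S j + 1) :
    ∃ α : ℝ, ∀ n i, (S (i + n) - S i - 1 : ℝ) ≤ n * α ∧ n * α ≤ (S (i + n) - S i + 1 : ℝ) := by
  have cross : ∀ m n i j : ℕ, (n : ℤ) * (S (i + m) - S i - 1) ≤ m * (S (j + n) - S j + 1) := by
    intro m n i j
    have h1 := mul_le_of_le_block (S := S) (c := S (i + m) - S i - 1) (m := m)
      (fun k => by have := hb m i k; omega) n
    have h2 := mul_le_of_le_block (S := fun k => - S k) (c := -(S (j + n) - S j + 1)) (m := n)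
      (fun k => by have := hb n k j; omega) m
    rw [mul_comm m n] at h2
    linarith
  set B : Set ℝ := {x | ∃ m i : ℕ, 0 < m ∧ x = (S (i + m) - S i - 1 : ℝ) / m} with hB
  have hub : ∀ n j : ℕ, 0 < n → ∀ x ∈ B, x ≤ (S (j + n) - S j + 1 : ℝ) / n := by
    rintro n j hn x ⟨m, i, hm, rfl⟩
    rw [div_le_div_iff₀ (by exact_mod_cast hm) (by exact_mod_cast hn)]
    have h := cross m n i j
    have h' : (n : ℝ) * (S (i + m) - S i - 1) ≤ m * (S (j + n) - S j + 1) := by exact_mod_cast h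
    linarith
  refine ⟨sSup B, fun n i => ?_⟩
  rcases Nat.eq_zero_or_pos n with rfl | hn
  · simp
  have hn' : (0 : ℝ) < n := by exact_mod_cast hn
  have hmem : (S (i + n) - S i - 1 : ℝ) / n ∈ B := ⟨n, i, hn, rfl⟩
  constructor
  · have := le_csSup ⟨_, hub n i hn⟩ hmem
    rw [div_le_iff₀ hn'] at this
    linarith
  · have := csSup_le ⟨_, hmem⟩ (hub n i hn)
    rw [le_div_iff₀ hn'] at this
    linarith

/-- A series of nonnegative integers with bounded partial sums is eventually zero. -/
theorem eventually_eq_zero_of_sum_bounded {T : ℕ → ℤ} (hT : ∀ i, 0 ≤ T i) {C : ℤ}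
    (hC : ∀ n, ∑ j ∈ Finset.range n, T j ≤ C) : ∃ n₀, ∀ i, n₀ ≤ i → T i = 0 := by
  obtain ⟨M, ⟨n₀, hn₀⟩, hM⟩ := Int.exists_greatest_of_bdd
    (P := fun z => ∃ n, ∑ j ∈ Finset.range n, T j = z)
    ⟨C, by rintro z ⟨n, rfl⟩; exact hC n⟩ ⟨_, 0, rfl⟩
  refine ⟨n₀, fun i hi => ?_⟩
  have h1 := hM _ ⟨i + 1, rfl⟩
  rw [Finset.sum_range_succ] at h1
  have h2 := Finset.sum_le_sum_of_subset_of_nonneg (Finset.range_mono hi)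
    (fun j _ _ => hT j)
  have h3 := hT i
  omega

/-- The slope of a balanced aperiodic word is irrational. -/
theorem slope_irrational {w : ℕ → Bool} (hper : ¬ UltPeriodicW w)
    (hb : ∀ n i j, trueSum w (i + n) - trueSum w i ≤ trueSum w (j + n) - trueSum w j + 1)
    {α : ℝ} (hα : ∀ n i, (trueSum w (i + n) - trueSum w i - 1 : ℝ) ≤ n * α ∧
      n * α ≤ (trueSum w (i + n) - trueSum w i + 1 : ℝ))
    {q : ℕ} (hq : 0 < q) (p : ℤ) : (q : ℝ) * α ≠ p := by
  intro hp
  set T : ℕ → ℤ := fun i => trueSum w (i + q) - trueSum w i - p with hT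
  have hsum : ∀ n, ((∑ j ∈ Finset.range n, T j : ℤ) : ℝ) =
      ∑ r ∈ Finset.range q, ((trueSum w (r + n) - trueSum w r : ℝ) - n * α) := by
    intro n
    induction n with
    | zero => simp
    | succ n ih =>
      rw [Finset.sum_range_succ, Int.cast_add, ih]
      have h1 : ((T n : ℤ) : ℝ) =
          ∑ r ∈ Finset.range q, ((trueSum w (n + (r + 1)) - trueSum w (n + r) : ℝ) - α) := by
        rw [Finset.sum_sub_distrib, Finset.sum_range_sub (fun r => (trueSum w (n + r) : ℝ))]
        simp [hT, hp]
      rw [h1, ← Finset.sum_add_distrib]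
      refine Finset.sum_congr rfl fun r _ => ?_
      rw [show n + (r + 1) = r + (n + 1) by omega, show n + r = r + n by omega]
      push_cast
      ring
  have habs : ∀ n, |((∑ j ∈ Finset.range n, T j : ℤ) : ℝ)| ≤ q := by
    intro n
    rw [hsum]
    refine (Finset.abs_sum_le_sum_abs _ _).trans ?_
    refine (Finset.sum_le_card_nsmul _ _ 1 fun r _ => ?_).trans (by simp)
    rw [abs_le]
    have := hα n r
    constructor <;> linarith
  have habs' : ∀ n, |∑ j ∈ Finset.range n, T j| ≤ (q : ℤ) := fun n => by exact_mod_cast habs n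
  have hzero : ∃ n₀, ∀ i, n₀ ≤ i → T i = 0 := by
    by_cases hpos : ∀ i, 0 ≤ T i
    · exact eventually_eq_zero_of_sum_bounded hpos fun n => (abs_le.1 (habs' n)).2
    · have hneg : ∀ i, T i ≤ 0 := by
        intro i
        push Not at hpos
        obtain ⟨j, hj⟩ := hpos
        have := hb q i j
        simp only [hT] at hj ⊢
        omega
      obtain ⟨n₀, hn₀⟩ := eventually_eq_zero_of_sum_bounded (T := fun i => - T i) (C := q)
        (fun i => by have := hneg i; omega)
        (fun n => by
          rw [Finset.sum_neg_distrib]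
          have := (abs_le.1 (habs' n)).1
          omega)
      exact ⟨n₀, fun i hi => by have := hn₀ i hi; omega⟩
  obtain ⟨n₀, hn₀⟩ := hzero
  refine hper ⟨q, hq, n₀, fun n hn => ?_⟩
  have h1 := hn₀ n hn
  have h2 := hn₀ (n + 1) (by omega)
  simp only [hT] at h1 h2
  rw [show n + 1 + q = n + q + 1 by omega, trueSum_succ, trueSum_succ] at h2
  revert h2
  cases w (n + q) <;> cases w n <;> simp <;> omega

/-- Mechanical representation: the prefix sums of a Sturmian word are, up to sign and an additive
constant, of the form `⌊x + iα⌋`. -/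
theorem SturmianW.exists_floor {w : ℕ → Bool} (hst : SturmianW w) :
    ∃ (x α : ℝ) (ε c : ℤ), (ε = 1 ∨ ε = -1) ∧ ∀ i : ℕ, trueSum w i = ε * ⌊x + i * α⌋ + c := by
  have hb : ∀ n i j, trueSum w (i + n) - trueSum w i ≤ trueSum w (j + n) - trueSum w j + 1 :=
    fun n => hst.balanced n
  obtain ⟨α, hα⟩ := exists_slope hb
  have hirr := fun (q : ℕ) (hq : 0 < q) (p : ℤ) => slope_irrational hst.1 hb hα hq p
  have hpair : ∀ i j : ℕ, (trueSum w j - j * α : ℝ) ≤ trueSum w i - i * α + 1 := by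
    intro i j
    rcases le_total i j with h | h
    · obtain ⟨n, rfl⟩ := Nat.exists_eq_add_of_le h
      have := (hα n i).1
      push_cast
      linarith
    · obtain ⟨n, rfl⟩ := Nat.exists_eq_add_of_le h
      have := (hα n j).2
      push_cast
      linarith
  set x : ℝ := ⨆ i : ℕ, (trueSum w i - i * α : ℝ) with hx
  have hbdd : BddAbove (Set.range fun i : ℕ => (trueSum w i - i * α : ℝ)) :=
    ⟨_, by rintro _ ⟨j, rfl⟩; exact hpair 0 j⟩
  have hlow : ∀ i : ℕ, (trueSum w i : ℝ) ≤ x + i * α := by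
    intro i
    have := le_ciSup hbdd i
    linarith
  have hupp : ∀ i : ℕ, x + i * α ≤ trueSum w i + 1 := by
    intro i
    have : x ≤ trueSum w i - i * α + 1 := ciSup_le fun j => hpair i j
    linarith
  by_cases hex : ∃ i₀ : ℕ, x + i₀ * α = trueSum w i₀ + 1
  · obtain ⟨i₀, hi₀⟩ := hex
    refine ⟨-x, -α, -1, -1, Or.inr rfl, fun i => ?_⟩
    have hstrict : (trueSum w i : ℝ) < x + i * α := by
      refine lt_of_le_of_ne (hlow i) fun heq => ?_
      rcases lt_trichotomy i i₀ with h | rfl | h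
      · refine hirr (i₀ - i) (by omega) (trueSum w i₀ + 1 - trueSum w i) ?_
        rw [Nat.cast_sub h.le]
        push_cast
        linarith
      · linarith
      · refine hirr (i - i₀) (by omega) (trueSum w i - (trueSum w i₀ + 1)) ?_
        rw [Nat.cast_sub h.le]
        push_cast
        linarith
    have hfl : ⌊-x + i * -α⌋ = -trueSum w i - 1 := by
      rw [Int.floor_eq_iff]
      have := hupp i
      push_cast
      constructor <;> linarith
    rw [hfl]
    ring
  · push Not at hex
    refine ⟨x, α, 1, 0, Or.inl rfl, fun i => ?_⟩
    have hfl : ⌊x + i * α⌋ = trueSum w i :=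
      Int.floor_eq_iff.2 ⟨hlow i, lt_of_le_of_ne (hupp i) (hex i)⟩
    rw [hfl]
    ring

section Rotation

variable (α : ℝ) (n : ℕ) (k : ℤ)

/-- The set of points of the real line from which the rotation by `α` advances by `k` turns
in `n` steps. -/
def AdvanceSet : Set ℝ := {y | ⌊y + n * α⌋ - ⌊y⌋ = k}

/-- A point `y ∈ [0, 1)` of `AdvanceSet` whose orbit hits `-cα` modulo `1` at some time `m > 0`
without having returned to `AdvanceSet` before time `m`. -/
def IsCut (c : ℕ) (y : ℝ) : Prop :=
  0 ≤ y ∧ y < 1 ∧ y ∈ AdvanceSet α n k ∧ ∃ m : ℕ, 0 < m ∧ (∃ z : ℤ, y + (m + c : ℕ) * α = z) ∧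
    ∀ i : ℕ, 0 < i → i < m → y + i * α ∉ AdvanceSet α n k

variable {α n k}

theorem add_int_mem_advanceSet {y : ℝ} {z : ℤ} :
    y + z ∈ AdvanceSet α n k ↔ y ∈ AdvanceSet α n k := by
  simp only [AdvanceSet, Set.mem_ofPred_eq]
  rw [add_right_comm, Int.floor_add_intCast, Int.floor_add_intCast, add_sub_add_right_eq_sub]

theorem IsCut.unique {c : ℕ} {y₁ y₂ : ℝ} (h₁ : IsCut α n k c y₁) (h₂ : IsCut α n k c y₂) :
    y₁ = y₂ := by
  have not_before : ∀ {y₁ y₂ : ℝ} {m₁ m₂ : ℕ} {z₁ z₂ : ℤ}, y₁ ∈ AdvanceSet α n k → 0 < m₁ →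
      y₁ + (m₁ + c : ℕ) * α = z₁ → y₂ + (m₂ + c : ℕ) * α = z₂ →
      (∀ i : ℕ, 0 < i → i < m₂ → y₂ + i * α ∉ AdvanceSet α n k) → ¬ m₁ < m₂ := by
    intro y₁ y₂ m₁ m₂ z₁ z₂ hy hm hz₁ hz₂ hno hlt
    refine hno (m₂ - m₁) (by omega) (by omega) ?_
    have : y₂ + (m₂ - m₁ : ℕ) * α = y₁ + (z₂ - z₁ : ℤ) := by
      rw [Nat.cast_sub hlt.le]
      push_cast at *
      linarith
    rw [this]
    exact add_int_mem_advanceSet.2 hy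
  obtain ⟨h0, h1, hy, m₁, hm, ⟨z₁, hz₁⟩, hno⟩ := h₁
  obtain ⟨h0', h1', hy', m₂, hm', ⟨z₂, hz₂⟩, hno'⟩ := h₂
  have hm_eq : m₁ = m₂ := le_antisymm (not_lt.1 (not_before hy' hm' hz₂ hz₁ hno))
    (not_lt.1 (not_before hy hm hz₁ hz₂ hno'))
  subst hm_eq
  have e1 : ⌊y₁⌋ = 0 := Int.floor_eq_zero_iff.2 ⟨h0, h1⟩
  have e2 : ⌊y₂⌋ = 0 := Int.floor_eq_zero_iff.2 ⟨h0', h1'⟩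
  have h : y₁ = y₂ + (z₁ - z₂ : ℤ) := by push_cast; linarith
  have hz : z₁ - z₂ = 0 := by
    rw [h, Int.floor_add_intCast, e2] at e1
    omega
  rw [h, hz]
  simp

/-- `y ∈ AdvanceSet` returns to `AdvanceSet` under the rotation for the first time at `τ`. -/
def FirstReturn (α : ℝ) (n : ℕ) (k : ℤ) (y : ℝ) (τ : ℕ) : Prop :=
  y ∈ AdvanceSet α n k ∧ 0 < τ ∧ y + τ * α ∈ AdvanceSet α n k ∧
    ∀ i : ℕ, 0 < i → i < τ → y + i * α ∉ AdvanceSet α n k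

/-- If no cut separates `a` and `b`, then their orbits have the same coding up to their common
first return time. -/
theorem FirstReturn.eq_of_not_isCut {a b : ℝ} {τ τ' : ℕ} (ha : FirstReturn α n k a τ)
    (hb : FirstReturn α n k b τ') (h0 : 0 ≤ a) (hab : a ≤ b) (h1 : b < 1)
    (hcut : ∀ c, c = 0 ∨ c = n → ∀ y, a < y → y ≤ b → ¬ IsCut α n k c y) :
    τ = τ' ∧ ∀ m ≤ τ, ⌊a + m * α⌋ = ⌊b + m * α⌋ := by
  have hmono : ∀ (t : ℝ), ⌊a + t⌋ ≤ ⌊b + t⌋ := fun t => Int.floor_le_floor (by linarith)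
  have fl_a : ⌊a⌋ = 0 := Int.floor_eq_zero_iff.2 ⟨h0, by linarith⟩
  have fl_b : ⌊b⌋ = 0 := Int.floor_eq_zero_iff.2 ⟨by linarith, h1⟩
  have agree : ∀ m ≤ min τ τ', ∀ c, c = 0 ∨ c = n →
      ⌊a + (m + c : ℕ) * α⌋ = ⌊b + (m + c : ℕ) * α⌋ := by
    intro m
    induction m using Nat.strong_induction_on with
    | _ m ih =>
      intro hm c hc
      rcases Nat.eq_zero_or_pos m with rfl | hpos
      · rcases hc with rfl | rfl
        · simp [fl_a, fl_b]
        · have e1 := ha.1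
          have e2 := hb.1
          simp only [AdvanceSet, Set.mem_ofPred_eq, fl_a, fl_b] at e1 e2
          rw [zero_add]
          omega
      · by_contra hne
        have hlt := lt_of_le_of_ne (hmono _) hne
        set z := ⌊b + (m + c : ℕ) * α⌋ with hz
        have hya : a < z - (m + c : ℕ) * α := by
          have := Int.floor_lt.1 hlt
          linarith
        have hyb : z - (m + c : ℕ) * α ≤ b := by
          have := Int.floor_le (b + (m + c : ℕ) * α)
          linarith
        set y : ℝ := z - (m + c : ℕ) * α with hy
        have fl_y : ∀ i < m, ∀ d, d = 0 ∨ d = n →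
            ⌊y + (i + d : ℕ) * α⌋ = ⌊a + (i + d : ℕ) * α⌋ := by
          intro i hi d hd
          have e1 := ih i hi (by omega) d hd
          refine le_antisymm ?_ (Int.floor_le_floor (by linarith))
          rw [e1]
          exact Int.floor_le_floor (by linarith)
        have mem_y : ∀ i < m, (y + i * α ∈ AdvanceSet α n k ↔ a + i * α ∈ AdvanceSet α n k) := by
          intro i hi
          have e1 := fl_y i hi 0 (Or.inl rfl)
          have e2 := fl_y i hi n (Or.inr rfl)
          rw [Nat.add_zero] at e1
          rw [Nat.cast_add, add_mul, ← add_assoc, ← add_assoc] at e2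
          simp only [AdvanceSet, Set.mem_ofPred_eq, e1, e2]
        refine hcut c hc y hya hyb ⟨by linarith, by linarith, ?_, m, hpos, ⟨z, by rw [hy]; ring⟩,
          fun i hi him => ?_⟩
        · have := (mem_y 0 hpos)
          simp only [Nat.cast_zero, zero_mul, add_zero] at this
          exact this.2 ha.1
        · rw [mem_y i him]
          exact ha.2.2.2 i hi (by omega)
  have mem_iff : ∀ m ≤ min τ τ', (a + m * α ∈ AdvanceSet α n k ↔ b + m * α ∈ AdvanceSet α n k) := by
    intro m hm
    have e1 := agree m hm 0 (Or.inl rfl)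
    have e2 := agree m hm n (Or.inr rfl)
    rw [Nat.add_zero] at e1
    rw [Nat.cast_add, add_mul, ← add_assoc, ← add_assoc] at e2
    simp only [AdvanceSet, Set.mem_ofPred_eq, e1, e2]
  have hτ : τ = τ' := by
    rcases lt_trichotomy τ τ' with h | h | h
    · exact absurd ((mem_iff τ (by omega)).1 ha.2.2.1) (hb.2.2.2 τ ha.2.1 h)
    · exact h
    · exact absurd ((mem_iff τ' (by omega)).2 hb.2.2.1) (ha.2.2.2 τ' hb.2.1 h)
  refine ⟨hτ, fun m hm => ?_⟩
  have := agree m (by omega) 0 (Or.inl rfl)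
  rwa [Nat.add_zero] at this

/-- The circle is cut into three classes, on each of which the coding of first returns is
constant. -/
theorem exists_classes_firstReturn (α : ℝ) (n : ℕ) (k : ℤ) :
    ∃ κ : ℝ → Fin 3, ∀ a b τ τ', FirstReturn α n k a τ → FirstReturn α n k b τ' →
      0 ≤ a → a < 1 → 0 ≤ b → b < 1 → κ a = κ b →
      τ = τ' ∧ ∀ m ≤ τ, ⌊a + m * α⌋ = ⌊b + m * α⌋ := by
  have hex : ∀ c, ∃ y, ∀ y', IsCut α n k c y' → y' = y := by
    intro c
    by_cases h : ∃ y, IsCut α n k c y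
    · obtain ⟨y, hy⟩ := h
      exact ⟨y, fun y' hy' => hy'.unique hy⟩
    · exact ⟨0, fun y' hy' => absurd ⟨y', hy'⟩ h⟩
  choose cut hcut using hex
  classical
  set ν : ℝ → ℕ := fun x => (if cut 0 ≤ x then 1 else 0) + (if cut n ≤ x then 1 else 0) with hν
  have hlt : ∀ x, ν x < 3 := by
    intro x
    simp only [hν]
    split_ifs <;> omega
  have main : ∀ a b τ τ', FirstReturn α n k a τ → FirstReturn α n k b τ' →
      0 ≤ a → a ≤ b → b < 1 → ν a = ν b → τ = τ' ∧ ∀ m ≤ τ, ⌊a + m * α⌋ = ⌊b + m * α⌋ := by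
    intro a b τ τ' ha hb h0 hab h1 heq
    refine ha.eq_of_not_isCut hb h0 hab h1 fun c hc y hy hyb hy_cut => ?_
    have hyc := hcut c y hy_cut
    have i1 : cut 0 ≤ a → cut 0 ≤ b := fun h => h.trans hab
    have i2 : cut n ≤ a → cut n ≤ b := fun h => h.trans hab
    have i3 : cut c ≤ b := hyc ▸ hyb
    have i4 : ¬ cut c ≤ a := not_le.2 (hyc ▸ hy)
    simp only [hν] at heq
    rcases hc with rfl | rfl
    · split_ifs at heq <;> first | omega | tauto
    · split_ifs at heq <;> first | omega | tauto
  refine ⟨fun x => ⟨ν x, hlt x⟩, fun a b τ τ' ha hb a0 a1 b0 b1 heq => ?_⟩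
  have heq' : ν a = ν b := by simpa using heq
  rcases le_total a b with h | h
  · exact main a b τ τ' ha hb a0 h b1 heq'
  · obtain ⟨e1, e2⟩ := main b a τ' τ hb ha b0 h a1 heq'.symm
    exact ⟨e1.symm, fun m hm => (e2 m (by omega)).symm⟩

end Rotation

/-- Every factor of a Sturmian word has at most three semi-abelian returns. -/
theorem stmt8 (w : ℕ → Bool) (hst : SturmianW w) (u : List Bool)
    (hu : IsFactorW w u) (hne : u ≠ []) :
    ∃ f : Fin 3 → List Bool, semiAbReturns w u ⊆ Set.range f := by
  obtain ⟨x, α, ε, c, hε, hfloor⟩ := hst.exists_floor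
  set n := u.length with hn
  set k : ℤ := ε * u.count true with hk
  set X : ℕ → ℝ := fun i => Int.fract (x + i * α) with hX
  have hfl : ∀ i m : ℕ, trueSum w (i + m) = ε * (⌊X i + m * α⌋ + ⌊x + i * α⌋) + c := by
    intro i m
    rw [hfloor, ← Int.floor_add_intCast]
    congr 3
    simp only [hX, Int.fract]
    push_cast
    ring
  have hocc : ∀ i m : ℕ, i + m ∈ abOcc w u ↔ X i + m * α ∈ AdvanceSet α n k := by
    intro i m
    rw [mem_abOcc_iff, add_assoc, hfl, hfl]
    simp only [AdvanceSet, Set.mem_ofPred_eq, ← hn, hk]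
    rw [Nat.cast_add, add_mul, ← add_assoc]
    rcases hε with rfl | rfl <;> constructor <;> intro h <;> linarith
  have hfirst : ∀ i j, i ∈ abOcc w u → j ∈ abOcc w u → i < j →
      (∀ l, i < l → l < j → l ∉ abOcc w u) → FirstReturn α n k (X i) (j - i) := by
    intro i j hi hj hij hno
    refine ⟨?_, by omega, ?_, fun m hm hmj => ?_⟩
    · simpa using (hocc i 0).1 hi
    · rw [← hocc, Nat.add_sub_cancel' hij.le]
      exact hj
    · rw [← hocc]
      exact hno _ (by omega) (by omega)
  have hword : ∀ i i' τ : ℕ, (∀ m ≤ τ, ⌊X i + m * α⌋ = ⌊X i' + m * α⌋) →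
      wordAt w i τ = wordAt w i' τ := by
    intro i i' τ h
    refine wordAt_eq_iff.2 fun m hm => ?_
    have e1 := trueSum_succ w (i + m)
    have e2 := trueSum_succ w (i' + m)
    rw [add_assoc, hfl, hfl] at e1 e2
    rw [h m hm.le, h (m + 1) hm] at e1
    have e3 : (if w (i + m) then (1 : ℤ) else 0) = if w (i' + m) then 1 else 0 := by linarith
    revert e3
    cases w (i + m) <;> cases w (i' + m) <;> simp
  obtain ⟨κ, hκ⟩ := exists_classes_firstReturn α n k
  have hex : ∀ d : Fin 3, ∃ r₀ : List Bool, ∀ i j, i ∈ abOcc w u → j ∈ abOcc w u → i < j →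
      (∀ l, i < l → l < j → l ∉ abOcc w u) → κ (X i) = d → wordAt w i (j - i) = r₀ := by
    intro d
    by_cases h : ∃ i j, i ∈ abOcc w u ∧ j ∈ abOcc w u ∧ i < j ∧
        (∀ l, i < l → l < j → l ∉ abOcc w u) ∧ κ (X i) = d
    · obtain ⟨i, j, hi, hj, hij, hno, hd⟩ := h
      refine ⟨wordAt w i (j - i), fun i' j' hi' hj' hij' hno' hd' => ?_⟩
      obtain ⟨e1, e2⟩ := hκ _ _ _ _ (hfirst i' j' hi' hj' hij' hno') (hfirst i j hi hj hij hno)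
        (Int.fract_nonneg _) (Int.fract_lt_one _) (Int.fract_nonneg _) (Int.fract_lt_one _)
        (hd'.trans hd.symm)
      rw [← e1]
      exact hword _ _ _ e2
    · exact ⟨[], fun i j hi hj hij hno hd => absurd ⟨i, j, hi, hj, hij, hno, hd⟩ h⟩
  choose f hf using hex
  refine ⟨f, ?_⟩
  rintro r ⟨i, j, hi, hj, hij, hno, rfl⟩
  exact ⟨κ (X i), (hf _ i j hi hj hij hno rfl).symm⟩
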